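/- Let G be a finite simple graph with mad(G) < 14/5 and ch_3^d(G) > 7 such that every proper subgraph H of G (obtained from G by deleting at least one vertex or at least one edge) satisfies ch_3^d(H) ≤ 7. Then for each k ∈ {3, 4}, every vertex of G of degree k has at most k − 2 neighbors of degree 2. -/

import Mathlib

open SimpleGraph

/-- `φ` is a proper coloring of `G` that is 3-dynamic: every vertex `v` sees at least
`min 3 (deg v)` distinct colors on its neighborhood. -/
def IsDyn3Coloring {V : Type*} (G : SimpleGraph V) (φ : V → ℕ) : Prop :=
  (∀ u v, G.Adj u v → φ u ≠ φ v) ∧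
  ∀ v, min 3 (G.neighborSet v).ncard ≤ (φ '' G.neighborSet v).ncard

/-- `G` is 3-dynamically colorable from the list assignment `L`. -/
def Dyn3ListColorable {V : Type*} (G : SimpleGraph V) (L : V → Finset ℕ) : Prop :=
  ∃ φ : V → ℕ, IsDyn3Coloring G φ ∧ ∀ v, φ v ∈ L v

/-- `ch_3^d(G) ≤ k` : `G` is 3-dynamically `L`-colorable for every list assignment `L`
with `|L v| ≥ k` for all `v`. -/
def Ch3dLE {V : Type*} (G : SimpleGraph V) (k : ℕ) : Prop :=
  ∀ L : V → Finset ℕ, (∀ v, k ≤ (L v).card) → Dyn3ListColorable G L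

/-- `mad(G) < c` : every nonempty subgraph has average degree `< c`. -/
def MadLT {V : Type*} (G : SimpleGraph V) (c : ℚ) : Prop :=
  ∀ H : G.Subgraph, H.verts.Nonempty →
    (2 * H.edgeSet.ncard : ℚ) / (H.verts.ncard : ℚ) < c

/-- `mad(G) ≤ c` : every nonempty subgraph has average degree `≤ c`. -/
def MadLE {V : Type*} (G : SimpleGraph V) (c : ℚ) : Prop :=
  ∀ H : G.Subgraph, H.verts.Nonempty →
    (2 * H.edgeSet.ncard : ℚ) / (H.verts.ncard : ℚ) ≤ c

/-- Every proper subgraph of `G` (deleting at least one vertex or edge) has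
`ch_3^d ≤ k`. -/
def ProperSubgraphsCh3dLE {V : Type*} (G : SimpleGraph V) (k : ℕ) : Prop :=
  ∀ H : G.Subgraph, H ≠ ⊤ → Ch3dLE H.coe k

/-- `x ∈ W_i(G)` : `x` has degree 3 and exactly `i` neighbors of degree 2. -/
def Wmem {V : Type*} (G : SimpleGraph V) (i : ℕ) (x : V) : Prop :=
  (G.neighborSet x).ncard = 3 ∧
    {y | G.Adj x y ∧ (G.neighborSet y).ncard = 2}.ncard = i

/-- `y` is a weak neighbor of `x` : they are distinct and have a common neighbor of
degree 2. -/
def WeakAdj {V : Type*} (G : SimpleGraph V) (x y : V) : Prop :=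
  x ≠ y ∧ ∃ w, G.Adj x w ∧ G.Adj y w ∧ (G.neighborSet w).ncard = 2

def PGood {V : Type*} (G : SimpleGraph V) (L : V → Finset ℕ) (φ : V → ℕ) (S : Set V) : Prop :=
  (∀ u ∈ S, ∀ v ∈ S, G.Adj u v → φ u ≠ φ v) ∧
  (∀ w, min 3 (G.neighborSet w ∩ S).ncard ≤ (φ '' (G.neighborSet w ∩ S)).ncard) ∧
  ∀ v ∈ S, φ v ∈ L v

open Classical in
noncomputable def Forb {V : Type*} [Fintype V] (G : SimpleGraph V) (φ : V → ℕ) (S : Set V)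
    (w : V) : Finset ℕ :=
  (if w ∈ S then {φ w} else ∅) ∪
  (if (φ '' (G.neighborSet w ∩ S)).ncard ≤ 2 then
    (Set.toFinite (φ '' (G.neighborSet w ∩ S))).toFinset else ∅)

open Classical in
lemma forb_card_le {V : Type*} [Fintype V] (G : SimpleGraph V) (φ : V → ℕ) (S : Set V)
    (w : V) : (Forb G φ S w).card ≤ 3 := by
  unfold Forb
  refine (Finset.card_union_le _ _).trans ?_
  have h1 : (if w ∈ S then ({φ w} : Finset ℕ) else ∅).card ≤ 1 := by split_ifs <;> simp
  have h2 : (if (φ '' (G.neighborSet w ∩ S)).ncard ≤ 2 then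
    (Set.toFinite (φ '' (G.neighborSet w ∩ S))).toFinset else ∅).card ≤ 2 := by
    split_ifs with h
    · rwa [← Set.ncard_eq_toFinset_card _ (Set.toFinite _)]
    · simp
  omega

open Classical in
lemma forb_card_le_one {V : Type*} [Fintype V] (G : SimpleGraph V) (φ : V → ℕ) (S : Set V)
    (w : V) (hw : w ∉ S) (h : (G.neighborSet w ∩ S).ncard ≤ 1) : (Forb G φ S w).card ≤ 1 := by
  unfold Forb
  rw [if_neg hw, Finset.empty_union]
  split_ifs with h'
  · rw [← Set.ncard_eq_toFinset_card _ (Set.toFinite _)]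
    exact (Set.ncard_image_le (Set.toFinite _)).trans h
  · simp

open Classical in
lemma extend_one {V : Type*} [Fintype V] (G : SimpleGraph V) (L : V → Finset ℕ) (φ : V → ℕ)
    (S : Set V) (u : V) (hu : u ∉ S) (hL : 7 ≤ (L u).card) (hφ : PGood G L φ S)
    (hc : ∑ w ∈ (G.neighborSet u).toFinset, (Forb G φ S w).card ≤ 6) :
    ∃ φ', PGood G L φ' (insert u S) := by
  obtain ⟨c, hcL, hcF⟩ : ∃ c ∈ L u, c ∉ (G.neighborSet u).toFinset.biUnion (Forb G φ S) := by
    apply Finset.exists_mem_notMem_of_card_lt_card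
    have := Finset.card_biUnion_le (s := (G.neighborSet u).toFinset) (t := Forb G φ S)
    omega
  have hF : ∀ w, G.Adj u w → c ∉ Forb G φ S w := by
    intro w hw hcw
    exact hcF (Finset.mem_biUnion.2 ⟨w, by simpa using hw, hcw⟩)
  have hF1 : ∀ w ∈ S, G.Adj u w → c ≠ φ w := by
    intro w hw ha e
    apply hF w ha
    simp [Forb, hw, e]
  have hF2 : ∀ w, G.Adj u w → (φ '' (G.neighborSet w ∩ S)).ncard ≤ 2 →
      c ∉ φ '' (G.neighborSet w ∩ S) := by
    intro w ha h2 hm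
    apply hF w ha
    unfold Forb
    rw [if_pos h2]
    exact Finset.mem_union_right _ (by simpa using hm)
  obtain ⟨p1, p2, p3⟩ := hφ
  have hne : ∀ w ∈ S, Function.update φ u c w = φ w := by
    intro w hw
    rw [Function.update_of_ne]
    rintro rfl
    exact hu hw
  refine ⟨Function.update φ u c, ?_, ?_, ?_⟩
  · rintro a (rfl | ha) b (rfl | hb) hab
    · exact absurd hab (G.loopless.irrefl _)
    · rw [hne b hb, Function.update_self]
      exact hF1 b hb hab
    · rw [hne a ha, Function.update_self]
      exact (hF1 a ha hab.symm).symm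
    · rw [hne a ha, hne b hb]
      exact p1 a ha b hb hab
  · intro w
    have him : Function.update φ u c '' (G.neighborSet w ∩ S) = φ '' (G.neighborSet w ∩ S) :=
      Set.image_congr (fun a ha => hne a ha.2)
    have := p2 w
    by_cases huw : G.Adj w u
    · rw [Set.inter_insert_of_mem (by exact huw), Set.image_insert_eq, him, Function.update_self]
      have h1 : (insert u (G.neighborSet w ∩ S)).ncard = (G.neighborSet w ∩ S).ncard + 1 :=
        Set.ncard_insert_of_notMem (fun h => hu h.2) (Set.toFinite _)
      by_cases h2 : (φ '' (G.neighborSet w ∩ S)).ncard ≤ 2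
      · rw [Set.ncard_insert_of_notMem (hF2 w huw.symm h2) (Set.toFinite _)]
        omega
      · have := Set.ncard_le_ncard (Set.subset_insert c (φ '' (G.neighborSet w ∩ S)))
          (Set.toFinite _)
        omega
    · rw [Set.inter_insert_of_notMem (by exact huw), him]
      exact this
  · rintro a (rfl | ha)
    · rwa [Function.update_self]
    · rw [hne a ha]
      exact p3 a ha

open Classical in
lemma extend_many {V : Type*} [Fintype V] (G : SimpleGraph V) (L : V → Finset ℕ)
    (hL : ∀ v, 7 ≤ (L v).card) (S : Set V) (hS : ∃ φ, PGood G L φ S) (T : Finset V)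
    (hT : ∀ x ∈ T, (G.neighborSet x).ncard = 2) :
    ∃ φ, PGood G L φ (S ∪ T) := by
  induction T using Finset.induction_on with
  | empty => simpa using hS
  | insert x T hx ih =>
    obtain ⟨φ, hφ⟩ := ih (fun y hy => hT y (Finset.mem_insert_of_mem hy))
    have e : S ∪ (insert x T : Finset V) = insert x (S ∪ (T : Set V)) := by
      rw [Finset.coe_insert, Set.union_insert]
    rw [e]
    by_cases hm : x ∈ S ∪ (T : Set V)
    · rw [Set.insert_eq_of_mem hm]
      exact ⟨φ, hφ⟩
    · apply extend_one G L φ _ x hm (hL x) hφ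
      have h2 := hT x (Finset.mem_insert_self _ _)
      rw [Set.ncard_eq_toFinset_card'] at h2
      have := Finset.sum_le_card_nsmul (G.neighborSet x).toFinset
        (fun w => (Forb G φ (S ∪ (T : Set V)) w).card) 3 (fun w _ => forb_card_le _ _ _ _)
      rw [h2] at this
      simpa using this

open Classical in
lemma base_coloring {V : Type*} [Fintype V] (G : SimpleGraph V) (L : V → Finset ℕ)
    (hL : ∀ v, 7 ≤ (L v).card) (hmin : ProperSubgraphsCh3dLE G 7) (S : Set V) (v : V) (hv : v ∉ S)
    (h1 : ∀ w, w ∉ S → (G.neighborSet w ∩ S).ncard ≤ 1) :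
    ∃ φ, PGood G L φ S := by
  have hH : (⊤ : G.Subgraph).induce S ≠ ⊤ := by
    intro h
    have : ((⊤ : G.Subgraph).induce S).verts = (⊤ : G.Subgraph).verts := by rw [h]
    simp only [Subgraph.induce_verts, Subgraph.verts_top] at this
    rw [this] at hv
    exact hv trivial
  obtain ⟨φ, ⟨p1, p2⟩, p3⟩ := hmin _ hH (fun w => L w) (fun w => hL w)
  let ψ : V → ℕ := fun w => if h : w ∈ S then φ ⟨w, h⟩ else 0
  have hψ : ∀ w (h : w ∈ S), ψ w = φ ⟨w, h⟩ := fun w h => dif_pos h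
  refine ⟨ψ, ?_, ?_, ?_⟩
  · intro a ha b hb hab
    rw [hψ a ha, hψ b hb]
    apply p1
    simp [ha, hb, hab]
  · intro w
    by_cases hw : w ∈ S
    · have hs : G.neighborSet w ∩ S =
          Subtype.val '' (((⊤ : G.Subgraph).induce S).coe.neighborSet ⟨w, hw⟩) := by
        ext a
        constructor
        · rintro ⟨h, ha⟩
          have h : G.Adj w a := h
          exact ⟨⟨a, ha⟩, by simp [hw, ha, h], rfl⟩
        · rintro ⟨⟨a, ha⟩, h, rfl⟩
          have ha' : a ∈ S := ha
          simp [hw, ha'] at h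
          exact ⟨h, ha'⟩
      have h2 := p2 ⟨w, hw⟩
      rw [hs, Set.ncard_image_of_injective _ Subtype.val_injective, Set.image_image]
      have : (fun x : ((⊤ : G.Subgraph).induce S).verts => ψ x.1) = φ := by
        funext x
        exact hψ x.1 x.2
      rw [this]
      exact h2
    · have := h1 w hw
      have hi : Set.InjOn ψ (G.neighborSet w ∩ S) := by
        intro a ha b hb _
        exact (Set.ncard_le_one (Set.toFinite _)).1 this a ha b hb
      rw [Set.ncard_image_of_injOn hi]
      exact min_le_right _ _
  · intro a ha
    rw [hψ a ha]
    exact p3 ⟨a, ha⟩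

theorem min_counterexample7_few_two_neighbors {V : Type*} [Fintype V]
    (G : SimpleGraph V) (hmad : MadLT G (14 / 5)) (hG : ¬ Ch3dLE G 7)
    (hmin : ProperSubgraphsCh3dLE G 7) :
    ∀ k ∈ ({3, 4} : Set ℕ), ∀ v : V, (G.neighborSet v).ncard = k →
      {y | G.Adj v y ∧ (G.neighborSet y).ncard = 2}.ncard ≤ k - 2 := by
  classical
  intro k hk v hv
  have hk4 : k ≤ 4 := by rcases hk with rfl | rfl <;> norm_num
  by_contra hlt
  push Not at hlt
  apply hG
  intro L hL
  set T : Set V := {y | G.Adj v y ∧ (G.neighborSet y).ncard = 2} with hT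
  have hTN : T ⊆ G.neighborSet v := fun y hy => hy.1
  have hvT : v ∉ T := fun h => G.loopless.irrefl _ h.1
  have hdiff : (G.neighborSet v \ T).ncard + T.ncard = k := by
    rw [Set.ncard_sdiff_add_ncard_of_subset hTN (Set.toFinite _), hv]
  set S : Set V := (insert v T)ᶜ with hS
  have hvS : v ∉ S := fun h => h (Set.mem_insert _ _)
  have hTS : ∀ x ∈ T, x ∉ S := fun x hx h => h (Set.mem_insert_of_mem _ hx)
  have h1T : ∀ x ∈ T, (G.neighborSet x ∩ S).ncard ≤ 1 := by
    intro x hx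
    have hsub : G.neighborSet x ∩ S ⊆ G.neighborSet x \ {v} := by
      rintro a ⟨ha, haS⟩
      refine ⟨ha, ?_⟩
      rintro rfl
      exact hvS haS
    have := Set.ncard_le_ncard hsub (Set.toFinite _)
    have h3 := Set.ncard_sdiff_singleton_of_mem (show v ∈ G.neighborSet x from hx.1.symm)
    have := hx.2
    omega
  have h1 : ∀ w, w ∉ S → (G.neighborSet w ∩ S).ncard ≤ 1 := by
    intro w hw
    have hw' : w ∈ insert v T := not_not.1 hw
    rcases hw' with rfl | hw'
    · have hsub : G.neighborSet w ∩ S ⊆ G.neighborSet w \ T :=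
        fun a ha => ⟨ha.1, fun h => hTS a h ha.2⟩
      have := Set.ncard_le_ncard hsub (Set.toFinite _)
      omega
    · exact h1T w hw'
  obtain ⟨φ, hφ⟩ := base_coloring G L hL hmin S v hvS h1
  have hv1 : ∃ φ', PGood G L φ' (insert v S) := by
    apply extend_one G L φ S v hvS (hL v) hφ
    have hb : ∀ w ∈ (G.neighborSet v).toFinset,
        (Forb G φ S w).card ≤ 1 + if w ∈ T then 0 else 2 := by
      intro w _
      split_ifs with h
      · exact forb_card_le_one G φ S w (hTS w h) (h1T w h)
      · exact forb_card_le G φ S w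
    refine (Finset.sum_le_sum hb).trans ?_
    rw [Finset.sum_add_distrib, Finset.sum_ite]
    have e1 : (G.neighborSet v).toFinset.card = k := by
      rw [← Set.ncard_eq_toFinset_card', hv]
    have e2 : ((G.neighborSet v).toFinset.filter (fun w => w ∉ T)).card
        = (G.neighborSet v \ T).ncard := by
      rw [← Set.ncard_coe_finset]
      congr 1
      ext a
      simp
    simp only [Finset.sum_const, e1, e2, smul_eq_mul]
    omega
  obtain ⟨ψ, q1, q2, q3⟩ := extend_many G L hL (insert v S) hv1 T.toFinset (by
    intro x hx
    rw [Set.mem_toFinset] at hx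
    exact hx.2)
  have hU : insert v S ∪ (T.toFinset : Set V) = Set.univ := by
    rw [Set.coe_toFinset, hS]
    ext a
    simp only [Set.mem_union, Set.mem_insert_iff, Set.mem_compl_iff, Set.mem_univ, iff_true]
    tauto
  rw [hU] at q1 q2 q3
  refine ⟨ψ, ⟨fun a b => q1 a trivial b trivial, fun w => ?_⟩, fun a => q3 a trivial⟩
  simpa using q2 w
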